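/- (The paper's identity h^{AB}𝔻_{A(Q}𝔻_{|B|P)₀}V = −X_{(Q}𝔻_{P)₀}V to order Q⁰ along the cone, in the flat model for scalars.) Let f be a smooth function on ℝ^N ∖ {0} homogeneous of weight w ∈ ℝ, and define T_{QP} = Σ_{A,B} h^{AB} · 𝔻_{AQ}(𝔻_{BP} f) and S_{QP} = X_Q · (D^{(w)} f)_P for indices Q, P ∈ Fin N. Then for all Q, P ∈ Fin N, the function TF(T)_{QP} + TF(S)_{QP} is O(Q), i.e. there are smooth functions g_{QP} on ℝ^N ∖ {0} with TF(T)_{QP} + TF(S)_{QP} = Q · g_{QP}. -/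

import Mathlib

open scoped BigOperators

/-- Partial derivative in the `A`-th coordinate direction. -/
noncomputable def pd {N : ℕ} (A : Fin N) (f : (Fin N → ℝ) → ℝ) : (Fin N → ℝ) → ℝ :=
  fun x => fderiv ℝ f x (Pi.single A 1)

/-- Ambient Laplacian `Δf = ∑_{A,B} h^{AB} ∂_A ∂_B f` w.r.t. the inverse metric `hInv`. -/
noncomputable def lap {N : ℕ} (hInv : Matrix (Fin N) (Fin N) ℝ)
    (f : (Fin N → ℝ) → ℝ) : (Fin N → ℝ) → ℝ :=
  fun x => ∑ A : Fin N, ∑ B : Fin N, hInv A B * pd A (pd B f) x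

/-- `X_A(x) = ∑_B h_{AB} x^B`. -/
def Xc {N : ℕ} (h : Matrix (Fin N) (Fin N) ℝ) (A : Fin N) : (Fin N → ℝ) → ℝ :=
  fun x => ∑ B : Fin N, h A B * x B

/-- `Q(x) = ∑_{A,B} h_{AB} x^A x^B`. -/
def Qfun {N : ℕ} (h : Matrix (Fin N) (Fin N) ℝ) : (Fin N → ℝ) → ℝ :=
  fun x => ∑ A : Fin N, ∑ B : Fin N, h A B * x A * x B

/-- Smooth (C^∞) on `ℝ^N ∖ {0}`. -/
def SmoothOffZero {N : ℕ} (f : (Fin N → ℝ) → ℝ) : Prop :=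
  ContDiffOn ℝ (⊤ : ℕ∞) f {x : Fin N → ℝ | x ≠ 0}

/-- Homogeneous of weight `w` on `ℝ^N ∖ {0}`. -/
def Homog {N : ℕ} (w : ℝ) (f : (Fin N → ℝ) → ℝ) : Prop :=
  ∀ x : Fin N → ℝ, x ≠ 0 → (∑ A : Fin N, x A * pd A f x) = w * f x

/-- Ambient tractor-D operator at weight `w`: `(D^{(w)} f)_A = (n+2w−2)∂_A f − X_A Δf`. -/
noncomputable def Dop {N : ℕ} (n : ℕ) (h hInv : Matrix (Fin N) (Fin N) ℝ) (w : ℝ)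
    (f : (Fin N → ℝ) → ℝ) (A : Fin N) : (Fin N → ℝ) → ℝ :=
  fun x => ((n : ℝ) + 2 * w - 2) * pd A f x - Xc h A x * lap hInv f x

/-- Iterated tractor-D: `seqD … w0 f A 0 = f` and
`seqD … w0 f A (j+1) = (D^{(w0−j)} (seqD … w0 f A j))_{A (j+1)}`. -/
noncomputable def seqD {N : ℕ} (n : ℕ) (h hInv : Matrix (Fin N) (Fin N) ℝ)
    (w0 : ℝ) (f : (Fin N → ℝ) → ℝ) (A : ℕ → Fin N) : ℕ → (Fin N → ℝ) → ℝ
  | 0 => f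
  | j + 1 => Dop n h hInv (w0 - (j : ℝ)) (seqD n h hInv w0 f A j) (A (j + 1))

/-- `u` is `O(Q^m)`: `u = Q^m · g` for some smooth `g` on `ℝ^N ∖ {0}`. -/
def BigOQ {N : ℕ} (h : Matrix (Fin N) (Fin N) ℝ) (m : ℕ) (u : (Fin N → ℝ) → ℝ) : Prop :=
  ∃ g : (Fin N → ℝ) → ℝ, SmoothOffZero g ∧
    ∀ x : Fin N → ℝ, x ≠ 0 → u x = (Qfun h x) ^ m * g x

/-- The double-D operator `𝔻_{AP} u = X_P ∂_A u − X_A ∂_P u`. -/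
noncomputable def DD {N : ℕ} (h : Matrix (Fin N) (Fin N) ℝ) (A P : Fin N)
    (u : (Fin N → ℝ) → ℝ) : (Fin N → ℝ) → ℝ :=
  fun x => Xc h P x * pd A u x - Xc h A x * pd P u x

/-- Trace-free symmetric part of a two-index family of functions:
`TF(S)_{QP} = (S_{QP}+S_{PQ})/2 − h_{QP}·(∑_{C,E} h^{CE} S_{CE})/(n+2)`. -/
noncomputable def TFpart {N : ℕ} (n : ℕ) (h hInv : Matrix (Fin N) (Fin N) ℝ)
    (S : Fin N → Fin N → (Fin N → ℝ) → ℝ) (Q P : Fin N) : (Fin N → ℝ) → ℝ :=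
  fun x => (S Q P x + S P Q x) / 2
    - h Q P * (∑ C : Fin N, ∑ E : Fin N, hInv C E * S C E x) / ((n : ℝ) + 2)

theorem SmoothOffZero.contDiffAt {N : ℕ} {f : (Fin N → ℝ) → ℝ} (hf : SmoothOffZero f)
    {x : Fin N → ℝ} (hx : x ≠ 0) : ContDiffAt ℝ (⊤ : ℕ∞) f x :=
  ContDiffOn.contDiffAt hf (isOpen_ne.mem_nhds hx)

theorem SmoothOffZero.differentiableAt {N : ℕ} {f : (Fin N → ℝ) → ℝ} (hf : SmoothOffZero f)
    {x : Fin N → ℝ} (hx : x ≠ 0) : DifferentiableAt ℝ f x :=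
  (hf.contDiffAt hx).differentiableAt (by simp)

theorem SmoothOffZero.pd {N : ℕ} {f : (Fin N → ℝ) → ℝ} (hf : SmoothOffZero f) (A : Fin N) :
    SmoothOffZero (pd A f) :=
  (ContDiffOn.fderiv_of_isOpen (m := (⊤ : ℕ∞)) hf isOpen_ne (by simp)).clm_apply contDiffOn_const

theorem SmoothOffZero.lap {N : ℕ} {f : (Fin N → ℝ) → ℝ} (hf : SmoothOffZero f)
    (hInv : Matrix (Fin N) (Fin N) ℝ) : SmoothOffZero (lap hInv f) :=
  ContDiffOn.sum fun A _ => ContDiffOn.sum fun B _ => contDiffOn_const.mul ((hf.pd B).pd A)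

theorem pd_pd_comm {N : ℕ} {f : (Fin N → ℝ) → ℝ} (hf : SmoothOffZero f) (A B : Fin N)
    {x : Fin N → ℝ} (hx : x ≠ 0) : pd A (pd B f) x = pd B (pd A f) x := by
  have hd : DifferentiableAt ℝ (fderiv ℝ f) x :=
    ((hf.contDiffAt hx).fderiv_right (m := (⊤ : ℕ∞)) (by simp)).differentiableAt (by simp)
  have hpd (C D : Fin N) : pd C (pd D f) x
      = fderiv ℝ (fderiv ℝ f) x (Pi.single C 1) (Pi.single D 1) := by
    unfold _root_.pd
    rw [fderiv_clm_apply hd (differentiableAt_const _)]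
    simp
  rw [hpd, hpd]
  exact (hf.contDiffAt hx).isSymmSndFDerivAt
    (by simpa using WithTop.coe_le_coe.2 (le_top : (2 : ℕ∞) ≤ ⊤)) _ _

theorem pd_mul {N : ℕ} {u v : (Fin N → ℝ) → ℝ} (A : Fin N) {x : Fin N → ℝ}
    (hu : DifferentiableAt ℝ u x) (hv : DifferentiableAt ℝ v x) :
    pd A (fun y => u y * v y) x = u x * pd A v x + v x * pd A u x := by
  simp [pd, fderiv_fun_mul hu hv]

theorem pd_sub {N : ℕ} {u v : (Fin N → ℝ) → ℝ} (A : Fin N) {x : Fin N → ℝ}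
    (hu : DifferentiableAt ℝ u x) (hv : DifferentiableAt ℝ v x) :
    pd A (fun y => u y - v y) x = pd A u x - pd A v x := by
  simp [pd, fderiv_fun_sub hu hv]

theorem pd_sum {N : ℕ} {ι : Type*} (s : Finset ι) {u : ι → (Fin N → ℝ) → ℝ} (A : Fin N)
    {x : Fin N → ℝ} (hu : ∀ i ∈ s, DifferentiableAt ℝ (u i) x) :
    pd A (fun y => ∑ i ∈ s, u i y) x = ∑ i ∈ s, pd A (u i) x := by
  simp [pd, fderiv_fun_sum hu]

theorem pd_const_mul {N : ℕ} {u : (Fin N → ℝ) → ℝ} (c : ℝ) (A : Fin N) {x : Fin N → ℝ}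
    (hu : DifferentiableAt ℝ u x) : pd A (fun y => c * u y) x = c * pd A u x := by
  simp [pd, fderiv_const_mul hu]

theorem pd_coord {N : ℕ} (A B : Fin N) (x : Fin N → ℝ) :
    pd A (fun y => y B) x = if B = A then 1 else 0 := by
  have : fderiv ℝ (fun y : Fin N → ℝ => y B) x = ContinuousLinearMap.proj B :=
    (ContinuousLinearMap.proj (R := ℝ) (φ := fun _ : Fin N => ℝ) B).fderiv
  simp [pd, this, Pi.single_apply]

theorem differentiable_Xc {N : ℕ} (h : Matrix (Fin N) (Fin N) ℝ) (P : Fin N) :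
    Differentiable ℝ (Xc h P) := by
  unfold Xc
  fun_prop

theorem pd_Xc {N : ℕ} (h : Matrix (Fin N) (Fin N) ℝ) (A P : Fin N) (x : Fin N → ℝ) :
    pd A (Xc h P) x = h P A := by
  unfold Xc
  rw [pd_sum _ _ fun i _ => by fun_prop]
  simp [pd_const_mul _ _ (differentiableAt_apply _ x), pd_coord]

open scoped Topology in
theorem pd_congr {N : ℕ} {u v : (Fin N → ℝ) → ℝ} (A : Fin N) {x : Fin N → ℝ} (hx : x ≠ 0)
    (huv : ∀ y, y ≠ 0 → u y = v y) : pd A u x = pd A v x := by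
  have : u =ᶠ[𝓝 x] v := Filter.mem_of_superset (isOpen_ne.mem_nhds hx) huv
  simp [pd, this.fderiv_eq]

/-- A partial derivative lowers the weight of homogeneity by one. -/
theorem Homog.pd {N : ℕ} {w : ℝ} {f : (Fin N → ℝ) → ℝ} (hf : SmoothOffZero f)
    (hhom : Homog w f) (B : Fin N) : Homog (w - 1) (pd B f) := by
  intro x hx
  have key := pd_congr B hx hhom
  rw [pd_const_mul _ _ (hf.differentiableAt hx), pd_sum _ _ fun A _ =>
    (differentiableAt_apply A x).fun_mul ((hf.pd A).differentiableAt hx)] at key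
  simp only [pd_mul _ (differentiableAt_apply _ x) ((hf.pd _).differentiableAt hx), pd_coord,
    Finset.sum_add_distrib, mul_ite, mul_one, mul_zero, Finset.sum_ite_eq', Finset.mem_univ,
    if_true] at key
  simp only [pd_pd_comm hf _ B hx]
  linarith

theorem pd_DD {N : ℕ} (h : Matrix (Fin N) (Fin N) ℝ) {f : (Fin N → ℝ) → ℝ}
    (hf : SmoothOffZero f) (A B P : Fin N) {x : Fin N → ℝ} (hx : x ≠ 0) :
    pd A (DD h B P f) x = Xc h P x * pd A (pd B f) x + pd B f x * h P A
      - (Xc h B x * pd A (pd P f) x + pd P f x * h B A) := by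
  have hX (C : Fin N) : DifferentiableAt ℝ (Xc h C) x := differentiable_Xc h C x
  have hd (C : Fin N) : DifferentiableAt ℝ (pd C f) x := (hf.pd C).differentiableAt hx
  unfold DD
  rw [pd_sub _ ((hX P).fun_mul (hd B)) ((hX B).fun_mul (hd P)), pd_mul _ (hX P) (hd B),
    pd_mul _ (hX B) (hd P), pd_Xc, pd_Xc]

section Contraction

variable {N : ℕ} {h hInv : Matrix (Fin N) (Fin N) ℝ}

theorem sum_inv_mul_metric_mul (hInvh : h * hInv = 1) (P : Fin N) (v : Fin N → ℝ) :
    ∑ A, ∑ B, hInv A B * (h P A * v B) = v P := by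
  have hP (B : Fin N) : ∑ A, h P A * hInv A B = if P = B then 1 else 0 := by
    rw [← Matrix.mul_apply, hInvh, Matrix.one_apply]
  rw [Finset.sum_comm]
  calc ∑ B, ∑ A, hInv A B * (h P A * v B) = ∑ B, (∑ A, h P A * hInv A B) * v B := by
        simp only [Finset.sum_mul]
        exact Finset.sum_congr rfl fun B _ => Finset.sum_congr rfl fun A _ => by ring
    _ = v P := by simp [hP]

theorem sum_inv_mul_metric (hInvh : h * hInv = 1) :
    ∑ A, ∑ B, hInv A B * h B A = N := by
  have : (hInv * h).trace = N := by rw [Matrix.trace_mul_comm, hInvh]; simp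
  simpa [Matrix.trace, Matrix.mul_apply] using this

theorem sum_inv_mul_Xc_left (hSymm : ∀ A B, h A B = h B A) (hInvh : h * hInv = 1)
    (x v : Fin N → ℝ) :
    ∑ A, ∑ B, hInv A B * (Xc h A x * v B) = ∑ A, x A * v A := by
  calc ∑ A, ∑ B, hInv A B * (Xc h A x * v B)
      = ∑ A, ∑ B, ∑ C, x C * (hInv A B * (h C A * v B)) := by
        refine Finset.sum_congr rfl fun A _ => Finset.sum_congr rfl fun B _ => ?_
        rw [Xc, Finset.sum_mul, Finset.mul_sum]
        exact Finset.sum_congr rfl fun C _ => by rw [hSymm A C]; ring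
    _ = ∑ C, x C * ∑ A, ∑ B, hInv A B * (h C A * v B) := by
        simp only [Finset.mul_sum]
        rw [Finset.sum_comm' (t' := Finset.univ) (s' := fun _ => Finset.univ) (by simp)]
        rw [Finset.sum_congr rfl fun B _ => Finset.sum_comm, Finset.sum_comm]
        refine Finset.sum_congr rfl fun C _ => Finset.sum_comm
    _ = ∑ A, x A * v A := by simp only [sum_inv_mul_metric_mul hInvh]

theorem inv_metric_symm (hSymm : ∀ A B, h A B = h B A) (hInvh : h * hInv = 1) (A B : Fin N) :
    hInv A B = hInv B A := by
  have hh : h.IsSymm := Matrix.IsSymm.ext fun i j => hSymm j i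
  rw [← Matrix.inv_eq_right_inv hInvh]
  exact (hh.inv).apply B A

theorem sum_inv_mul_Xc_right (hSymm : ∀ A B, h A B = h B A) (hInvh : h * hInv = 1)
    (x v : Fin N → ℝ) :
    ∑ A, ∑ B, hInv A B * (Xc h B x * v A) = ∑ A, x A * v A := by
  rw [← sum_inv_mul_Xc_left hSymm hInvh x v, Finset.sum_comm]
  simp only [inv_metric_symm hSymm hInvh]

theorem sum_coord_mul_Xc (x : Fin N → ℝ) : ∑ A, x A * Xc h A x = Qfun h x := by
  simp only [Xc, Qfun, Finset.mul_sum]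
  exact Finset.sum_congr rfl fun A _ => Finset.sum_congr rfl fun B _ => by ring

end Contraction

/-- The contraction `h^{AB} 𝔻_{AQ} 𝔻_{BP} f`, before taking the trace-free symmetric part. -/
theorem sum_inv_mul_DD_DD {N : ℕ} {h hInv : Matrix (Fin N) (Fin N) ℝ}
    (hSymm : ∀ A B, h A B = h B A) (hInvh : h * hInv = 1) {w : ℝ} {f : (Fin N → ℝ) → ℝ}
    (hf : SmoothOffZero f) (hhom : Homog w f) (Q P : Fin N) {x : Fin N → ℝ} (hx : x ≠ 0) :
    ∑ A, ∑ B, hInv A B * DD h A Q (DD h B P f) x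
      = Xc h Q x * Xc h P x * lap hInv f x + (3 - N - w) * (Xc h Q x * pd P f x)
        - (w - 1) * (Xc h P x * pd Q f x) - h Q P * (w * f x)
        + Qfun h x * pd Q (pd P f) x := by
  have hDD (A B : Fin N) : DD h A Q (DD h B P f) x
      = Xc h Q x * pd A (DD h B P f) x - Xc h A x * pd Q (DD h B P f) x := rfl
  have expand : ∑ A, ∑ B, hInv A B * DD h A Q (DD h B P f) x
      = Xc h Q x * Xc h P x * lap hInv f x
        + Xc h Q x * (∑ A, ∑ B, hInv A B * (h P A * pd B f x))
        - Xc h Q x * (∑ A, ∑ B, hInv A B * (Xc h B x * pd A (pd P f) x))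
        - Xc h Q x * pd P f x * (∑ A, ∑ B, hInv A B * h B A)
        - Xc h P x * (∑ A, ∑ B, hInv A B * (Xc h A x * pd Q (pd B f) x))
        - h P Q * (∑ A, ∑ B, hInv A B * (Xc h A x * pd B f x))
        + pd Q (pd P f) x * (∑ A, ∑ B, hInv A B * (Xc h A x * Xc h B x))
        + pd P f x * (∑ A, ∑ B, hInv A B * (Xc h A x * h Q B)) := by
    simp only [lap, Finset.mul_sum, ← Finset.sum_add_distrib, ← Finset.sum_sub_distrib]
    refine Finset.sum_congr rfl fun A _ => Finset.sum_congr rfl fun B _ => ?_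
    rw [hDD, pd_DD h hf _ _ _ hx, pd_DD h hf _ _ _ hx, hSymm Q B]
    ring
  have hXQ : ∑ B, x B * h Q B = Xc h Q x := Finset.sum_congr rfl fun B _ => mul_comm _ _
  have hhomP := hhom.pd hf P x hx
  have hhomQ := hhom.pd hf Q x hx
  simp only [← pd_pd_comm hf Q _ hx] at hhomQ
  rw [expand, sum_inv_mul_metric_mul hInvh, sum_inv_mul_metric hInvh,
    sum_inv_mul_Xc_right hSymm hInvh x fun A => pd A (pd P f) x,
    sum_inv_mul_Xc_left hSymm hInvh x fun B => pd Q (pd B f) x,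
    sum_inv_mul_Xc_left hSymm hInvh x fun B => pd B f x,
    sum_inv_mul_Xc_left hSymm hInvh x fun B => Xc h B x,
    sum_inv_mul_Xc_left hSymm hInvh x fun B => h Q B,
    sum_coord_mul_Xc, hXQ, hhomP, hhomQ, hhom x hx, hSymm P Q]
  ring

/-- with `T_{QP} = ∑_{A,B} h^{AB} 𝔻_{AQ} 𝔻_{BP} f` and
`S_{QP} = X_Q (D^{(w)} f)_P`, the function `TF(T)_{QP} + TF(S)_{QP}` is `O(Q)`. -/
theorem doubleD_squared_eq_Dop_mod_Q
    (n : ℕ) (hn : 1 ≤ n)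
    (h hInv : Matrix (Fin (n + 2)) (Fin (n + 2)) ℝ)
    (hSymm : ∀ A B, h A B = h B A) (hInvh : h * hInv = 1)
    (w : ℝ) (f : (Fin (n + 2) → ℝ) → ℝ) (hf : SmoothOffZero f) (hhom : Homog w f) :
    ∀ Q P : Fin (n + 2),
      BigOQ h 1 (fun x =>
        TFpart n h hInv
          (fun Q' P' y => ∑ A : Fin (n + 2), ∑ B : Fin (n + 2),
            hInv A B * DD h A Q' (DD h B P' f) y) Q P x
        + TFpart n h hInv
            (fun Q' P' y => Xc h Q' y * Dop n h hInv w f P' y) Q P x) := by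
  intro Q P
  refine ⟨fun x => pd Q (pd P f) x - h Q P * lap hInv f x / ((n : ℝ) + 2),
    ((hf.pd P).pd Q).sub ((contDiffOn_const.mul (hf.lap hInv)).div_const _), fun x hx => ?_⟩
  have hn2 : (n : ℝ) + 2 ≠ 0 := by positivity
  have hT (C E : Fin (n + 2)) := sum_inv_mul_DD_DD hSymm hInvh hf hhom C E hx
  push_cast at hT
  have htr : ∑ C, ∑ E, hInv C E * h C E = (n : ℝ) + 2 := by
    simpa only [hSymm, Nat.cast_add, Nat.cast_ofNat] using sum_inv_mul_metric hInvh
  have hswap : ∑ C, ∑ E, hInv C E * (Xc h E x * pd C f x)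
      = ∑ C, ∑ E, hInv C E * (Xc h C x * pd E f x) :=
    (sum_inv_mul_Xc_right hSymm hInvh x fun A => pd A f x).trans
      (sum_inv_mul_Xc_left hSymm hInvh x fun A => pd A f x).symm
  have htrace :
      (∑ C, ∑ E, hInv C E * ∑ A, ∑ B, hInv A B * DD h A C (DD h B E f) x)
        + ∑ C, ∑ E, hInv C E * (Xc h C x * Dop n h hInv w f E x)
      = Qfun h x * lap hInv f x - ((n : ℝ) + 2) * (w * f x) := by
    have expand :
        (∑ C, ∑ E, hInv C E * ∑ A, ∑ B, hInv A B * DD h A C (DD h B E f) x)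
          + ∑ C, ∑ E, hInv C E * (Xc h C x * Dop n h hInv w f E x)
        = Qfun h x * lap hInv f x - w * f x * (∑ C, ∑ E, hInv C E * h C E)
          + (w - 1) * (∑ C, ∑ E, hInv C E * (Xc h C x * pd E f x))
          - (w - 1) * (∑ C, ∑ E, hInv C E * (Xc h E x * pd C f x)) := by
      have hlap : lap hInv f x = ∑ C, ∑ E, hInv C E * pd C (pd E f) x := rfl
      nth_rewrite 1 [hlap]
      simp only [Finset.mul_sum (a := Qfun h x), Finset.mul_sum (a := w * f x),
        Finset.mul_sum (a := w - 1), ← Finset.sum_add_distrib, ← Finset.sum_sub_distrib]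
      refine Finset.sum_congr rfl fun C _ => Finset.sum_congr rfl fun E _ => ?_
      rw [hT C E, Dop]
      ring
    rw [expand, htr, hswap]
    ring
  have hsum (S R : ℝ) (hSR : S + R = Qfun h x * lap hInv f x - ((n : ℝ) + 2) * (w * f x)) :
      h Q P * S / ((n : ℝ) + 2) + h Q P * R / ((n : ℝ) + 2)
        = h Q P * (Qfun h x * lap hInv f x / ((n : ℝ) + 2) - w * f x) := by
    rw [← add_div, ← mul_add, hSR]
    field_simp
  have hTF := hsum _ _ htrace
  simp only [TFpart]
  rw [hT Q P, hT P Q]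
  simp only [Dop] at hTF ⊢
  rw [pd_pd_comm hf P Q hx, hSymm P Q]
  linear_combination -hTF
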